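/- arXiv:1608.03197 — 2 statements merged into one kernel-verified Lean document; each statement's English description precedes it below -/
import Mathlib

section
/- (Homogenization of variational expressions.) Let n ≥ 1 and let L(t, x, v, w) be smooth on ℝ × (ℝⁿ)³ and affine in w. Let E_i(t, x, v, w, w′) = ∂L/∂x^i − D_t(∂L/∂v^i) + D_t²(∂L/∂w^i) be its (third-order) Euler–Poisson expressions. On the open set {u⁰ > 0} of the variables (x⁰, x, u⁰, u, a⁰, a, j⁰, j) ∈ (ℝ × ℝⁿ)⁴ define 𝓛(x⁰, x, u⁰, u, a⁰, a) = u⁰ · L( x⁰, x, u/u⁰, (u⁰ a − a⁰ u)/(u⁰)³ ), and let 𝓔_α (α = 0, 1, …, n) be its Euler–Poisson expressions 𝓔_α = ∂𝓛/∂q^α − D(∂𝓛/∂q̇^α) + D²(∂𝓛/∂q̈^α) with q = (x⁰, x), q̇ = (u⁰, u), q̈ = (a⁰, a), q⃛ = (j⁰, j), and total derivative D = q̇·∂_q + q̈·∂_{q̇} + q⃛·∂_{q̈} (since 𝓛 is affine in (a⁰, a), the 𝓔_α depend only on (q, q̇, q̈, q⃛)). Then, identically on {u⁰ > 0}: 𝓔₀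 = − Σ_{i=1}^{n} u^i Ẽ_i and 𝓔_i = u⁰ Ẽ_i for i = 1, …, n, where Ẽ_i = E_i( x⁰, x, u/u⁰, (u⁰ a − a⁰ u)/(u⁰)³, ( (u⁰)² j − 3 u⁰ a⁰ a + (3 (a⁰)² − u⁰ j⁰) u ) / (u⁰)⁵ ). -/
noncomputable section

/-- Jet variables: time `t` together with rows `y₀, …, y_{N-1}` of `n` variables each. -/
abbrev Jet (n N : ℕ) : Type := ℝ × (Fin N → Fin n → ℝ)

/-- Coordinate access, out-of-range rows giving `0`. -/
def coord {n N : ℕ} (p : Jet n N) (r : ℕ) (i : Fin n) : ℝ :=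
  if h : r < N then p.2 ⟨r, h⟩ i else 0

/-- Partial derivative in the time direction. -/
def pderT {n N : ℕ} (F : Jet n N → ℝ) (p : Jet n N) : ℝ :=
  fderiv ℝ F p (1, 0)

/-- Partial derivative in the `i`-th variable of the `r`-th row `y_r`. -/
def pderY {n N : ℕ} (r : ℕ) (i : Fin n) (F : Jet n N → ℝ) : Jet n N → ℝ :=
  fun p => fderiv ℝ F p (0, fun r' => if (r' : ℕ) = r then Pi.single i 1 else 0)

/-- The total (formal time) derivative `D_t F = ∂F/∂t + Σ_r Σ_i y_{r+1}^i ∂F/∂y_r^i`,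
truncated at the top row. -/
def totD {n N : ℕ} (F : Jet n N → ℝ) : Jet n N → ℝ :=
  fun p => pderT F p + ∑ r ∈ Finset.range N, ∑ i : Fin n, coord p (r + 1) i * pderY r i F p

/-- Extension of a function of a lower-order jet to a higher-order jet space. -/
def extJ {n : ℕ} {N M : ℕ} (h : N ≤ M) (F : Jet n N → ℝ) : Jet n M → ℝ :=
  fun p => F (p.1, fun r => p.2 (Fin.castLE h r))

/-- Truncation of a jet to lower order. -/
def trJ {n : ℕ} {M : ℕ} (N : ℕ) (h : N ≤ M) (p : Jet n M) : Jet n N :=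
  (p.1, fun r => p.2 (Fin.castLE h r))


/-- The Euler–Poisson expressions `E_i(L) = ∂L/∂x^i − D_t(∂L/∂v^i) + D_t²(∂L/∂w^i)` of a
second-order Lagrange function `L(t,x,v,w)`, as functions of `(t,x,v,w,w′,w″)`. -/
def eulerPoisson2 {n : ℕ} (L : Jet n 3 → ℝ) (i : Fin n) : Jet n 5 → ℝ :=
  fun p =>
    pderY 0 i (extJ (M := 5) (by omega) L) p
      - totD (pderY 1 i (extJ (M := 5) (by omega) L)) p
      + totD (totD (pderY 2 i (extJ (M := 5) (by omega) L))) p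

/-- Antisymmetrization (weight `1/3!`) over three indices. -/
def alt3v {n : ℕ} (f : Fin n → Fin n → Fin n → ℝ) (i j k : Fin n) : ℝ :=
  (f i j k - f j i k + f j k i - f k j i + f k i j - f i k j) / 6

/-- Symmetrization (weight `1/3!`) over three indices. -/
def sym3v {n : ℕ} (f : Fin n → Fin n → Fin n → ℝ) (i j k : Fin n) : ℝ :=
  (f i j k + f j i k + f j k i + f k j i + f k i j + f i k j) / 6

/-- Parametric jet variables of order ≤ 3 in the extended configuration space `ℝ × ℝⁿ`:
`p r α` is the `r`-th parametric derivative of the `α`-th extended coordinate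
(`α = 0` corresponding to `x⁰ = t`). So `p 0 = q = (x⁰, x)`, `p 1 = q̇ = (u⁰, u)`,
`p 2 = q̈ = (a⁰, a)`, `p 3 = q⃛ = (j⁰, j)`. -/
abbrev PJet (n : ℕ) : Type := Fin 4 → Fin (n + 1) → ℝ

/-- Coordinate access on parametric jets, out-of-range giving `0`. -/
def pcoord {n : ℕ} (p : PJet n) (r : ℕ) (α : Fin (n + 1)) : ℝ :=
  if h : r < 4 then p ⟨r, h⟩ α else 0

/-- Partial derivative in the `α`-th extended coordinate of the `r`-th parametric
derivative row. -/
def pderP {n : ℕ} (r : ℕ) (α : Fin (n + 1)) (F : PJet n → ℝ) : PJet n → ℝ :=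
  fun p => fderiv ℝ F p (fun r' => if (r' : ℕ) = r then Pi.single α 1 else 0)

/-- The parametric total derivative `D = q̇·∂_q + q̈·∂_{q̇} + q⃛·∂_{q̈}`. -/
def totDP {n : ℕ} (F : PJet n → ℝ) : PJet n → ℝ :=
  fun p => ∑ r ∈ Finset.range 3, ∑ α : Fin (n + 1), pcoord p (r + 1) α * pderP r α F p

/-- The parametric Lagrange function `𝓛 = u⁰ · L(x⁰, x, u/u⁰, (u⁰a − a⁰u)/(u⁰)³)`. -/
def homLagP {n : ℕ} (L : Jet n 3 → ℝ) (p : PJet n) : ℝ :=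
  p 1 0 * L (p 0 0,
    ![fun i => p 0 i.succ,
      fun i => p 1 i.succ / p 1 0,
      fun i => (p 1 0 * p 2 i.succ - p 2 0 * p 1 i.succ) / p 1 0 ^ 3])

/-- The Euler–Poisson expressions `𝓔_α = ∂𝓛/∂q^α − D(∂𝓛/∂q̇^α) + D²(∂𝓛/∂q̈^α)` of the
parametric Lagrange function. -/
def homEP {n : ℕ} (L : Jet n 3 → ℝ) (α : Fin (n + 1)) (p : PJet n) : ℝ :=
  pderP 0 α (homLagP L) p - totDP (pderP 1 α (homLagP L)) p
    + totDP (totDP (pderP 2 α (homLagP L))) p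

/-- The Euler–Poisson expressions `E_i` of `L` evaluated on the first, second and third
derivatives of `x` with respect to `x⁰`, expressed through the parametric derivatives. -/
def pulledEP {n : ℕ} (L : Jet n 3 → ℝ) (i : Fin n) (p : PJet n) : ℝ :=
  eulerPoisson2 L i (p 0 0,
    ![fun i' => p 0 i'.succ,
      fun i' => p 1 i'.succ / p 1 0,
      fun i' => (p 1 0 * p 2 i'.succ - p 2 0 * p 1 i'.succ) / p 1 0 ^ 3,
      fun i' => (p 1 0 ^ 2 * p 3 i'.succ - 3 * p 1 0 * p 2 0 * p 2 i'.succ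
          + (3 * p 2 0 ^ 2 - p 1 0 * p 3 0) * p 1 i'.succ) / p 1 0 ^ 5,
      0])

open scoped ContDiff

/-- The shift of the rows of a jet: the vector part of the total derivative. -/
def jetShift {n N : ℕ} (p : Jet n N) : Fin N → Fin n → ℝ :=
  fun r i => coord p (r + 1) i

/-- The shift of the rows of a parametric jet, truncated at the top row. -/
def pjetShift {n : ℕ} (p : PJet n) : PJet n := ![p 1, p 2, p 3, 0]

theorem fderiv_jet_apply {n N : ℕ} (F : Jet n N → ℝ) (p : Jet n N) (τ : ℝ)
    (Z : Fin N → Fin n → ℝ) :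
    fderiv ℝ F p (τ, Z) = τ * pderT F p + ∑ r : Fin N, ∑ i, Z r i * pderY r i F p := by
  have h : ((τ, Z) : Jet n N) = τ • ((1, 0) : Jet n N) + ∑ r : Fin N, ∑ i : Fin n,
      Z r i • ((0, fun r' => if (r' : ℕ) = r then Pi.single i 1 else 0) : Jet n N) := by
    refine Prod.ext ?_ ?_
    · simp [Prod.fst_sum]
    · ext r j
      simp only [Prod.snd_add, Prod.snd_sum, Prod.smul_snd, Finset.sum_apply, Pi.add_apply,
        Pi.smul_apply, smul_zero, Pi.zero_apply, zero_add]
      rw [Finset.sum_eq_single r]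
      · simp [Pi.single_apply]
      · intro b _ hb
        have : (r : ℕ) ≠ b := fun h => hb (Fin.ext h.symm)
        simp [this]
      · simp
  rw [h]
  simp only [map_add, map_sum, map_smul, smul_eq_mul, pderT, pderY]

theorem totD_eq_fderiv {n N : ℕ} (F : Jet n N → ℝ) (p : Jet n N) :
    totD F p = fderiv ℝ F p (1, jetShift p) := by
  rw [fderiv_jet_apply, one_mul, totD, Finset.sum_range]
  rfl

theorem totDP_eq_fderiv {n : ℕ} (F : PJet n → ℝ) (p : PJet n) :
    totDP F p = fderiv ℝ F p (pjetShift p) := by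
  have h : pjetShift p = ∑ r ∈ Finset.range 3, ∑ α : Fin (n + 1), pcoord p (r + 1) α •
      ((fun r' => if (r' : ℕ) = r then Pi.single α 1 else 0) : PJet n) := by
    ext r α
    simp only [Finset.sum_range_succ, Finset.sum_range_zero, zero_add,
      Finset.sum_apply, Pi.smul_apply]
    fin_cases r <;> simp [pjetShift, pcoord, Pi.single_apply]
  rw [h]
  simp [map_sum, totDP, pderP]

section Derivations

variable {n N : ℕ} {F G : Jet n N → ℝ} {p : Jet n N}

theorem totD_add (hF : DifferentiableAt ℝ F p) (hG : DifferentiableAt ℝ G p) :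
    totD (fun q => F q + G q) p = totD F p + totD G p := by
  simp [totD_eq_fderiv, fderiv_fun_add hF hG]

theorem totD_sub (hF : DifferentiableAt ℝ F p) (hG : DifferentiableAt ℝ G p) :
    totD (fun q => F q - G q) p = totD F p - totD G p := by
  simp [totD_eq_fderiv, fderiv_fun_sub hF hG]

theorem totD_mul (hF : DifferentiableAt ℝ F p) (hG : DifferentiableAt ℝ G p) :
    totD (fun q => F q * G q) p = totD F p * G p + F p * totD G p := by
  simp [totD_eq_fderiv, fderiv_fun_mul hF hG]
  ring

theorem totD_sum {ι : Type*} (s : Finset ι) {F : ι → Jet n N → ℝ}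
    (hF : ∀ i ∈ s, DifferentiableAt ℝ (F i) p) :
    totD (fun q => ∑ i ∈ s, F i q) p = ∑ i ∈ s, totD (F i) p := by
  simp [totD_eq_fderiv, fderiv_fun_sum hF]

theorem totD_row (r : Fin N) (i : Fin n) :
    totD (fun q : Jet n N => q.2 r i) p = coord p (r + 1) i := by
  have h : HasFDerivAt (fun q : Jet n N => q.2 r i)
      ((ContinuousLinearMap.proj i).comp ((ContinuousLinearMap.proj r).comp
        (ContinuousLinearMap.snd ℝ ℝ (Fin N → Fin n → ℝ)))) p :=
    ((ContinuousLinearMap.proj i).comp ((ContinuousLinearMap.proj r).comp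
        (ContinuousLinearMap.snd ℝ ℝ (Fin N → Fin n → ℝ)))).hasFDerivAt
  rw [totD_eq_fderiv, h.fderiv]
  rfl

theorem contDiff_pderY (hF : ContDiff ℝ ∞ F) (r : ℕ) (i : Fin n) :
    ContDiff ℝ ∞ (pderY r i F) :=
  (hF.fderiv_right (m := ∞) (by simp)).clm_apply contDiff_const

theorem contDiff_jetShift : ContDiff ℝ ∞ (jetShift : Jet n N → Fin N → Fin n → ℝ) := by
  rw [contDiff_pi]; intro r
  rw [contDiff_pi]; intro i
  unfold jetShift coord
  split_ifs <;> fun_prop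

theorem contDiff_totD (hF : ContDiff ℝ ∞ F) : ContDiff ℝ ∞ (totD F) := by
  have : totD F = fun p => fderiv ℝ F p (1, jetShift p) := funext (totD_eq_fderiv F)
  rw [this]
  exact (hF.fderiv_right (m := ∞) (by simp)).clm_apply
    (contDiff_const.prodMk contDiff_jetShift)

end Derivations

/-- The function `F` only depends on the time and on the rows of index `< k`. -/
def JetOrderLT {n N : ℕ} (k : ℕ) (F : Jet n N → ℝ) : Prop :=
  ∀ (p : Jet n N) (z : Fin N → Fin n → ℝ), (∀ r : Fin N, (r : ℕ) < k → z r = 0) →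
    F (p + (0, z)) = F p

namespace JetOrderLT

variable {n N k : ℕ} {F G : Jet n N → ℝ}

theorem mono {l : ℕ} (hF : JetOrderLT k F) (h : k ≤ l) : JetOrderLT l F :=
  fun p z hz => hF p z fun r hr => hz r (hr.trans_le h)

theorem fderiv_eq (hF : JetOrderLT k F) (p : Jet n N) (z : Fin N → Fin n → ℝ)
    (hz : ∀ r : Fin N, (r : ℕ) < k → z r = 0) : fderiv ℝ F (p + (0, z)) = fderiv ℝ F p := by
  rw [← fderiv_comp_add_right]
  congr 1
  exact funext fun q => hF q z hz

theorem fderiv_apply_eq_zero (hF : JetOrderLT k F) (p : Jet n N) (z : Fin N → Fin n → ℝ)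
    (hz : ∀ r : Fin N, (r : ℕ) < k → z r = 0) : fderiv ℝ F p (0, z) = 0 := by
  by_cases hd : DifferentiableAt ℝ F p
  · rw [← hd.lineDeriv_eq_fderiv, lineDeriv]
    have : (fun t : ℝ => F (p + t • ((0, z) : Jet n N))) = fun _ => F p := by
      funext t
      have := hF p (t • z) fun r hr => by simp [hz r hr]
      simpa using this
    rw [this, deriv_const]
  · simp [fderiv_zero_of_not_differentiableAt hd]

theorem pderY_eq_zero (hF : JetOrderLT k F) {r : ℕ} (hr : k ≤ r) (i : Fin n) (p : Jet n N) :
    pderY r i F p = 0 :=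
  hF.fderiv_apply_eq_zero p _ fun r' hr' => if_neg (by omega)

theorem pderY (hF : JetOrderLT k F) (r : ℕ) (i : Fin n) : JetOrderLT k (pderY r i F) :=
  fun p z hz => by simp only [_root_.pderY, hF.fderiv_eq p z hz]

theorem totD (hF : JetOrderLT k F) : JetOrderLT (k + 1) (totD F) := by
  intro p z hz
  rw [totD_eq_fderiv, totD_eq_fderiv, hF.fderiv_eq p z fun r hr => hz r (by omega)]
  have h : ((1, jetShift (p + (0, z))) : Jet n N) = (1, jetShift p) + (0, jetShift (0, z)) := by
    refine Prod.ext (by simp) ?_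
    ext r i
    simp only [jetShift, coord, Prod.snd_add, Pi.add_apply]
    split_ifs <;> simp
  rw [h, map_add, hF.fderiv_apply_eq_zero p _ ?_, add_zero]
  intro r hr
  ext i
  simp only [jetShift, coord]
  split_ifs with h
  · rw [hz ⟨r + 1, h⟩ (by simpa using hr)]
  · rfl

theorem add (hF : JetOrderLT k F) (hG : JetOrderLT k G) : JetOrderLT k fun p => F p + G p :=
  fun p z hz => by simp only [hF p z hz, hG p z hz]

theorem sub (hF : JetOrderLT k F) (hG : JetOrderLT k G) : JetOrderLT k fun p => F p - G p :=
  fun p z hz => by simp only [hF p z hz, hG p z hz]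

theorem mul (hF : JetOrderLT k F) (hG : JetOrderLT k G) : JetOrderLT k fun p => F p * G p :=
  fun p z hz => by simp only [hF p z hz, hG p z hz]

theorem sum {ι : Type*} (s : Finset ι) {F : ι → Jet n N → ℝ}
    (hF : ∀ i ∈ s, JetOrderLT k (F i)) : JetOrderLT k fun p => ∑ i ∈ s, F i p :=
  fun p z hz => Finset.sum_congr rfl fun i hi => hF i hi p z hz

theorem row (r : Fin N) (hr : (r : ℕ) < k) (i : Fin n) :
    JetOrderLT k fun p : Jet n N => p.2 r i :=
  fun p z hz => by simp [hz r hr]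

end JetOrderLT

theorem jetOrderLT_extJ {n N M : ℕ} (h : N ≤ M) (F : Jet n N → ℝ) :
    JetOrderLT N (extJ h F) := by
  intro p z hz
  have : ∀ r : Fin N, z (Fin.castLE h r) = 0 := fun r => hz _ (by simp)
  simp [extJ, this]

theorem contDiff_extJ {n N M : ℕ} (h : N ≤ M) {F : Jet n N → ℝ} (hF : ContDiff ℝ ∞ F) :
    ContDiff ℝ ∞ (extJ h F) := by
  unfold extJ
  exact hF.comp (by fun_prop)

/-- The jet projection formulas. -/
def jetProj {n : ℕ} (p : PJet n) : Jet n 5 :=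
  (p 0 0,
    ![fun i' => p 0 i'.succ,
      fun i' => p 1 i'.succ / p 1 0,
      fun i' => (p 1 0 * p 2 i'.succ - p 2 0 * p 1 i'.succ) / p 1 0 ^ 3,
      fun i' => (p 1 0 ^ 2 * p 3 i'.succ - 3 * p 1 0 * p 2 0 * p 2 i'.succ
          + (3 * p 2 0 ^ 2 - p 1 0 * p 3 0) * p 1 i'.succ) / p 1 0 ^ 5,
      0])

theorem differentiableAt_jetProj {n : ℕ} {p : PJet n} (hp : 0 < p 1 0) :
    DifferentiableAt ℝ jetProj p := by
  have h0 : p 1 0 ≠ 0 := hp.ne'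
  have h3 : p 1 0 ^ 3 ≠ 0 := pow_ne_zero _ h0
  have h5 : p 1 0 ^ 5 ≠ 0 := pow_ne_zero _ h0
  unfold jetProj
  refine DifferentiableAt.prodMk (by fun_prop) ?_
  rw [differentiableAt_pi]; intro r
  rw [differentiableAt_pi]; intro i
  fin_cases r <;> simp <;> fun_prop (disch := assumption)

theorem fderiv_comp_jetProj {n : ℕ} {F : Jet n 5 → ℝ} (hF : ContDiff ℝ ∞ F)
    (hF3 : JetOrderLT 3 F) {p : PJet n} (hp : 0 < p 1 0) (e : PJet n) :
    fderiv ℝ (fun q => F (jetProj q)) p e = e 0 0 * pderT F (jetProj p)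
      + ∑ i : Fin n, (e 0 i.succ * pderY 0 i F (jetProj p)
        + (e 1 i.succ * p 1 0 - p 1 i.succ * e 1 0) / p 1 0 ^ 2 * pderY 1 i F (jetProj p)
        + ((e 1 0 * p 2 i.succ + p 1 0 * e 2 i.succ - e 2 0 * p 1 i.succ - p 2 0 * e 1 i.succ)
              / p 1 0 ^ 3
            - 3 * e 1 0 * (p 1 0 * p 2 i.succ - p 2 0 * p 1 i.succ) / p 1 0 ^ 4)
          * pderY 2 i F (jetProj p)) := by
  have h0 : p 1 0 ≠ 0 := hp.ne'
  have hd := differentiableAt_jetProj hp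
  have hFd : DifferentiableAt ℝ F (jetProj p) := (hF.differentiable (by simp)) _
  have hchain : fderiv ℝ (fun q => F (jetProj q)) p e
      = fderiv ℝ F (jetProj p) (fderiv ℝ jetProj p e) := by
    have := fderiv_comp p hFd hd
    exact congrArg (fun A => A e) this
  set V := fderiv ℝ jetProj p e with hV
  have hl : HasDerivAt (fun s : ℝ => jetProj (p + s • e)) V 0 :=
    hd.hasFDerivAt.hasLineDerivAt e
  have hc : ∀ (r : Fin 4) (α : Fin (n + 1)),
      HasDerivAt (fun s : ℝ => (p + s • e) r α) (e r α) 0 := by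
    intro r α
    simpa using ((hasDerivAt_id (0 : ℝ)).mul_const (e r α)).const_add (p r α)
  have hl1 : V.1 = e 0 0 := by
    have h1 : HasDerivAt (fun s : ℝ => (jetProj (p + s • e)).1) V.1 0 := hl.fst
    exact h1.unique (hc 0 0)
  have hl2 : ∀ (r : Fin 5) (i : Fin n),
      HasDerivAt (fun s : ℝ => (jetProj (p + s • e)).2 r i) (V.2 r i) 0 := fun r i =>
    hasDerivAt_pi.1 (hasDerivAt_pi.1 hl.snd r) i
  have hv0 : ∀ i, V.2 0 i = e 0 i.succ := fun i => (hl2 0 i).unique (hc 0 i.succ)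
  have hv1 : ∀ i, V.2 1 i = (e 1 i.succ * p 1 0 - p 1 i.succ * e 1 0) / p 1 0 ^ 2 := by
    intro i
    refine (hl2 1 i).unique ?_
    refine ((hc 1 i.succ).div (hc 1 0) (by simpa using h0)).congr_deriv ?_
    simp
  have hv2 : ∀ i, V.2 2 i =
      (e 1 0 * p 2 i.succ + p 1 0 * e 2 i.succ - e 2 0 * p 1 i.succ - p 2 0 * e 1 i.succ)
              / p 1 0 ^ 3
            - 3 * e 1 0 * (p 1 0 * p 2 i.succ - p 2 0 * p 1 i.succ) / p 1 0 ^ 4 := by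
    intro i
    refine (hl2 2 i).unique ?_
    have := (((hc 1 0).mul (hc 2 i.succ)).sub ((hc 2 0).mul (hc 1 i.succ))).div
      ((hc 1 0).pow 3) (by simpa using h0)
    refine this.congr_deriv ?_
    simp
    field_simp
    ring
  rw [hchain, ← Prod.mk.eta (p := V), fderiv_jet_apply, hl1]
  simp only [Fin.sum_univ_five]
  rw [← Finset.sum_add_distrib, ← Finset.sum_add_distrib, ← Finset.sum_add_distrib,
    ← Finset.sum_add_distrib]
  congr 1
  refine Finset.sum_congr rfl fun i _ => ?_
  have h3 := hF3.pderY_eq_zero (r := 3) le_rfl i (jetProj p)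
  have h4 := hF3.pderY_eq_zero (r := 4) (by omega) i (jetProj p)
  rw [hv0, hv1, hv2]
  simp [h3, h4]

theorem totD_eq_of_jetOrderLT_three {n : ℕ} {F : Jet n 5 → ℝ} (hF3 : JetOrderLT 3 F)
    (q : Jet n 5) :
    totD F q = pderT F q + ∑ i : Fin n, (q.2 1 i * pderY 0 i F q + q.2 2 i * pderY 1 i F q
      + q.2 3 i * pderY 2 i F q) := by
  simp only [totD, Finset.sum_range_succ, Finset.sum_range_zero, zero_add,
    hF3.pderY_eq_zero (r := 3) le_rfl, hF3.pderY_eq_zero (r := 4) (by omega), mul_zero,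
    Finset.sum_const_zero, add_zero, Finset.sum_add_distrib]
  rfl

theorem totDP_comp_jetProj {n : ℕ} {F : Jet n 5 → ℝ} (hF : ContDiff ℝ ∞ F)
    (hF3 : JetOrderLT 3 F) {p : PJet n} (hp : 0 < p 1 0) :
    totDP (fun q => F (jetProj q)) p = p 1 0 * totD F (jetProj p) := by
  have h0 : p 1 0 ≠ 0 := hp.ne'
  rw [totDP_eq_fderiv, fderiv_comp_jetProj hF hF3 hp, totD_eq_of_jetOrderLT_three hF3, mul_add,
    Finset.mul_sum]
  congr 1
  refine Finset.sum_congr rfl fun i _ => ?_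
  simp [pjetShift, jetProj]
  field_simp
  ring

theorem eventually_pos {n : ℕ} {p : PJet n} (hp : 0 < p 1 0) :
    ∀ᶠ q : PJet n in nhds p, 0 < q 1 0 :=
  (isOpen_lt continuous_const (by fun_prop)).mem_nhds hp

theorem totDP_congr {n : ℕ} {F G : PJet n → ℝ} {p : PJet n} (hp : 0 < p 1 0)
    (h : ∀ q : PJet n, 0 < q 1 0 → F q = G q) : totDP F p = totDP G p := by
  have : F =ᶠ[nhds p] G := (eventually_pos hp).mono h
  rw [totDP_eq_fderiv, totDP_eq_fderiv, this.fderiv_eq]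

theorem totDP_add {n : ℕ} {F G : PJet n → ℝ} {p : PJet n} (hF : DifferentiableAt ℝ F p)
    (hG : DifferentiableAt ℝ G p) : totDP (fun q => F q + G q) p = totDP F p + totDP G p := by
  simp [totDP_eq_fderiv, fderiv_fun_add hF hG]

theorem totDP_sub {n : ℕ} {F G : PJet n → ℝ} {p : PJet n} (hF : DifferentiableAt ℝ F p)
    (hG : DifferentiableAt ℝ G p) : totDP (fun q => F q - G q) p = totDP F p - totDP G p := by
  simp [totDP_eq_fderiv, fderiv_fun_sub hF hG]

theorem totDP_neg {n : ℕ} (F : PJet n → ℝ) (p : PJet n) :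
    totDP (fun q => -F q) p = -totDP F p := by
  simp [totDP_eq_fderiv, fderiv_fun_neg]

theorem differentiableAt_comp_jetProj {n : ℕ} {F : Jet n 5 → ℝ} (hF : ContDiff ℝ ∞ F)
    {p : PJet n} (hp : 0 < p 1 0) : DifferentiableAt ℝ (fun q => F (jetProj q)) p :=
  ((hF.differentiable (by simp)) (jetProj p)).comp p (differentiableAt_jetProj hp)

/-- The coordinate `u⁰` as a continuous linear functional. -/
def pjetSpeed (n : ℕ) : PJet n →L[ℝ] ℝ :=
  (ContinuousLinearMap.proj (R := ℝ) (φ := fun _ : Fin (n + 1) => ℝ) 0).comp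
    (ContinuousLinearMap.proj (φ := fun _ : Fin 4 => Fin (n + 1) → ℝ) 1)

@[simp]
theorem pjetSpeed_apply {n : ℕ} (p : PJet n) : pjetSpeed n p = p 1 0 := rfl

theorem totDP_comp_jetProj_div {n : ℕ} {F : Jet n 5 → ℝ} (hF : ContDiff ℝ ∞ F)
    (hF3 : JetOrderLT 3 F) {p : PJet n} (hp : 0 < p 1 0) :
    totDP (fun q => F (jetProj q) / q 1 0) p
      = totD F (jetProj p) - p 2 0 / p 1 0 ^ 2 * F (jetProj p) := by
  have h0 : p 1 0 ≠ 0 := hp.ne'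
  have hd := (differentiableAt_comp_jetProj hF hp).hasFDerivAt
  have hi : HasFDerivAt (fun q : PJet n => q 1 0) (pjetSpeed n) p := (pjetSpeed n).hasFDerivAt
  have hline : HasDerivAt (fun s : ℝ => (p + s • pjetShift p) 1 0) (p 2 0) 0 :=
    hi.hasLineDerivAt (pjetShift p)
  have hline' := hd.hasLineDerivAt (pjetShift p)
  rw [← totDP_eq_fderiv, totDP_comp_jetProj hF hF3 hp] at hline'
  have hline'' := (show HasDerivAt _ _ _ from hline').div hline (by simpa using h0)
  have hdiv : DifferentiableAt ℝ (fun q => F (jetProj q) / q 1 0) p :=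
    by
    simp only [div_eq_mul_inv]
    exact hd.differentiableAt.fun_mul (hi.differentiableAt.fun_inv h0)
  rw [totDP_eq_fderiv]
  refine ((show HasDerivAt _ _ _ from
    hdiv.hasFDerivAt.hasLineDerivAt (pjetShift p)).unique hline'').trans ?_
  simp only [zero_smul, add_zero]
  field_simp

/-- The extension of a Lagrange function to the jets of the Euler–Poisson expressions. -/
abbrev lagExt {n : ℕ} (L : Jet n 3 → ℝ) : Jet n 5 → ℝ := extJ (M := 5) (by omega) L

theorem homLagP_eq {n : ℕ} (L : Jet n 3 → ℝ) :
    homLagP L = fun q => q 1 0 * lagExt L (jetProj q) := by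
  funext q
  simp only [homLagP, lagExt, extJ, jetProj]
  congr 3
  funext r
  fin_cases r <;> rfl

theorem fderiv_homLagP {n : ℕ} {L : Jet n 3 → ℝ} (hL : ContDiff ℝ ∞ L) {p : PJet n}
    (hp : 0 < p 1 0) (e : PJet n) :
    fderiv ℝ (homLagP L) p e = e 1 0 * lagExt L (jetProj p)
      + p 1 0 * fderiv ℝ (fun q => lagExt L (jetProj q)) p e := by
  have hi : HasFDerivAt (fun q : PJet n => q 1 0) (pjetSpeed n) p := (pjetSpeed n).hasFDerivAt
  have hd := differentiableAt_comp_jetProj (contDiff_extJ (M := 5) (by omega) hL) hp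
  rw [homLagP_eq, fderiv_fun_mul hi.differentiableAt hd, hi.fderiv]
  simp
  ring

theorem pderP_zero_zero_homLagP {n : ℕ} {L : Jet n 3 → ℝ} (hL : ContDiff ℝ ∞ L) {p : PJet n}
    (hp : 0 < p 1 0) :
    pderP 0 0 (homLagP L) p = p 1 0 * pderT (lagExt L) (jetProj p) := by
  rw [pderP, fderiv_homLagP hL hp,
    fderiv_comp_jetProj (contDiff_extJ _ hL) (jetOrderLT_extJ _ L) hp]
  simp

theorem pderP_zero_succ_homLagP {n : ℕ} {L : Jet n 3 → ℝ} (hL : ContDiff ℝ ∞ L) {p : PJet n}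
    (hp : 0 < p 1 0) (i : Fin n) :
    pderP 0 i.succ (homLagP L) p = p 1 0 * pderY 0 i (lagExt L) (jetProj p) := by
  rw [pderP, fderiv_homLagP hL hp,
    fderiv_comp_jetProj (contDiff_extJ _ hL) (jetOrderLT_extJ _ L) hp]
  simp [Pi.single_apply]

theorem pderP_one_succ_homLagP {n : ℕ} {L : Jet n 3 → ℝ} (hL : ContDiff ℝ ∞ L) {p : PJet n}
    (hp : 0 < p 1 0) (i : Fin n) :
    pderP 1 i.succ (homLagP L) p = pderY 1 i (lagExt L) (jetProj p)
      - p 2 0 / p 1 0 ^ 2 * pderY 2 i (lagExt L) (jetProj p) := by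
  have h0 : p 1 0 ≠ 0 := hp.ne'
  rw [pderP, fderiv_homLagP hL hp,
    fderiv_comp_jetProj (contDiff_extJ _ hL) (jetOrderLT_extJ _ L) hp,
    Finset.sum_eq_single i _ (by simp)]
  · simp
    field_simp
    ring
  · intro j _ hj
    simp [hj]

theorem pderP_two_succ_homLagP {n : ℕ} {L : Jet n 3 → ℝ} (hL : ContDiff ℝ ∞ L) {p : PJet n}
    (hp : 0 < p 1 0) (i : Fin n) :
    pderP 2 i.succ (homLagP L) p = pderY 2 i (lagExt L) (jetProj p) / p 1 0 := by
  have h0 : p 1 0 ≠ 0 := hp.ne'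
  rw [pderP, fderiv_homLagP hL hp,
    fderiv_comp_jetProj (contDiff_extJ _ hL) (jetOrderLT_extJ _ L) hp,
    Finset.sum_eq_single i _ (by simp)]
  · simp
    field_simp
  · intro j _ hj
    simp [hj]

theorem pderP_one_zero_homLagP {n : ℕ} {L : Jet n 3 → ℝ} (hL : ContDiff ℝ ∞ L) {p : PJet n}
    (hp : 0 < p 1 0) :
    pderP 1 0 (homLagP L) p = (lagExt L (jetProj p)
        - ∑ i, (jetProj p).2 1 i * pderY 1 i (lagExt L) (jetProj p)
        - (∑ i, (jetProj p).2 2 i * pderY 2 i (lagExt L) (jetProj p)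
          + ∑ i, (jetProj p).2 2 i * pderY 2 i (lagExt L) (jetProj p)))
      + p 2 0 / p 1 0 ^ 2 * ∑ i, (jetProj p).2 1 i * pderY 2 i (lagExt L) (jetProj p) := by
  have h0 : p 1 0 ≠ 0 := hp.ne'
  rw [pderP, fderiv_homLagP hL hp,
    fderiv_comp_jetProj (contDiff_extJ _ hL) (jetOrderLT_extJ _ L) hp]
  rw [← Finset.sum_add_distrib, sub_sub, ← Finset.sum_add_distrib, Finset.mul_sum, sub_add,
    ← Finset.sum_sub_distrib, sub_eq_add_neg, ← Finset.sum_neg_distrib, mul_add, Finset.mul_sum]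
  congr 1
  · simp
  · simp only [Fin.isValue, Fin.val_zero, Fin.val_one, Fin.val_two, zero_ne_one, if_false,
      Pi.zero_apply, zero_mul, mul_zero, zero_add, if_true, Pi.single_eq_same]
    refine Finset.sum_congr rfl fun i _ => ?_
    simp [jetProj]
    field_simp
    ring

theorem pderP_two_zero_homLagP {n : ℕ} {L : Jet n 3 → ℝ} (hL : ContDiff ℝ ∞ L) {p : PJet n}
    (hp : 0 < p 1 0) :
    pderP 2 0 (homLagP L) p
      = -((∑ i, (jetProj p).2 1 i * pderY 2 i (lagExt L) (jetProj p)) / p 1 0) := by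
  have h0 : p 1 0 ≠ 0 := hp.ne'
  rw [pderP, fderiv_homLagP hL hp,
    fderiv_comp_jetProj (contDiff_extJ _ hL) (jetOrderLT_extJ _ L) hp]
  simp [Finset.sum_div]
  rw [← Finset.sum_neg_distrib, Finset.mul_sum]
  refine Finset.sum_congr rfl fun i _ => ?_
  simp [jetProj]
  field_simp

theorem jetOrderLT_pderY_two_lagExt {n : ℕ} {L : Jet n 3 → ℝ} (hL : ContDiff ℝ ∞ L)
    (haff : ∃ (α : Fin n → Jet n 2 → ℝ) (β : Jet n 2 → ℝ),
      ∀ p : Jet n 3,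
        L p = (∑ j, α j (trJ 2 (by omega) p) * coord p 2 j) + β (trJ 2 (by omega) p))
    (i : Fin n) : JetOrderLT 2 (pderY 2 i (lagExt L)) := by
  obtain ⟨α, β, h⟩ := haff
  have key : ∀ q : Jet n 5, pderY 2 i (lagExt L) q = α i (trJ 2 (by omega) q) := by
    intro q
    have hd : DifferentiableAt ℝ (lagExt L) q :=
      (contDiff_extJ (M := 5) (by omega) hL).differentiable (by simp) q
    have hline : HasDerivAt (fun s : ℝ => lagExt L (q + s •
        ((0, fun r' => if (r' : ℕ) = 2 then Pi.single i 1 else 0) : Jet n 5)))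
        (pderY 2 i (lagExt L) q) 0 := hd.hasFDerivAt.hasLineDerivAt _
    have hfun : (fun s : ℝ => lagExt L (q + s •
        ((0, fun r' => if (r' : ℕ) = 2 then Pi.single i 1 else 0) : Jet n 5)))
        = fun s => lagExt L q + s * α i (trJ 2 (by omega) q) := by
      funext s
      have htr : ∀ s : ℝ, trJ (n := n) (M := 3) 2 (by omega) ((q + s •
          ((0, fun r' => if (r' : ℕ) = 2 then Pi.single i 1 else 0) : Jet n 5)).1,
          fun r => (q + s • ((0, fun r' => if (r' : ℕ) = 2 then Pi.single i 1 else 0) :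
            Jet n 5)).2 (Fin.castLE (by omega) r)) = trJ 2 (by omega) q := by
        intro s
        refine Prod.ext (by simp [trJ]) ?_
        ext r j
        fin_cases r <;> simp [trJ]
      have htr0 : trJ (n := n) (M := 3) 2 (by omega) (q.1,
          fun r => q.2 (Fin.castLE (by omega) r)) = trJ 2 (by omega) q := rfl
      simp only [lagExt, extJ]
      rw [h, h, htr, htr0]
      have hc : ∀ j, coord (n := n) (N := 3) ((q + s •
          ((0, fun r' => if (r' : ℕ) = 2 then Pi.single i 1 else 0) : Jet n 5)).1,
          fun r => (q + s • ((0, fun r' => if (r' : ℕ) = 2 then Pi.single i 1 else 0) :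
            Jet n 5)).2 (Fin.castLE (by omega) r)) 2 j
          = coord (n := n) (N := 3) (q.1, fun r => q.2 (Fin.castLE (by omega) r)) 2 j
            + s * Pi.single (M := fun _ => ℝ) i 1 j := by
        intro j
        simp [coord]
      simp only [hc, mul_add, Finset.sum_add_distrib]
      have : ∑ j, α j (trJ 2 (by omega) q) * (s * Pi.single (M := fun _ => ℝ) i 1 j)
          = s * α i (trJ 2 (by omega) q) := by
        rw [Finset.sum_eq_single i _ (by simp)]
        · simp [mul_comm]
        · intro j _ hj
          simp [hj]
      rw [this]
      ring
    rw [hfun] at hline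
    refine hline.unique ?_
    simpa using ((hasDerivAt_id (0 : ℝ)).mul_const
      (α i (trJ 2 (by omega) q))).const_add (lagExt L q)
  intro q z hz
  rw [key, key]
  congr 1
  refine Prod.ext (by simp [trJ]) ?_
  ext r j
  simp [trJ, hz (Fin.castLE (by omega) r) r.isLt]

theorem homEP_succ {n : ℕ} {L : Jet n 3 → ℝ} (hL : ContDiff ℝ ∞ L)
    (hW : ∀ i, JetOrderLT 2 (pderY 2 i (lagExt L))) {p : PJet n} (hp : 0 < p 1 0) (i : Fin n) :
    homEP L i.succ p = p 1 0 * eulerPoisson2 L i (jetProj p) := by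
  have hΛ := contDiff_extJ (M := 5) (by omega) hL
  have hΛ3 := jetOrderLT_extJ (M := 5) (by omega) L
  have hW3 := (hW i).mono (show 2 ≤ 3 by omega)
  have hWs := contDiff_pderY hΛ 2 i
  have hVs := contDiff_pderY hΛ 1 i
  have hd : DifferentiableAt ℝ
      (fun q : PJet n => q 2 0 / q 1 0 ^ 2 * pderY 2 i (lagExt L) (jetProj q)) p := by
    have h0 : p 1 0 ^ 2 ≠ 0 := pow_ne_zero _ hp.ne'
    have := differentiableAt_comp_jetProj hWs hp
    fun_prop (disch := assumption)
  have e1 : totDP (pderP 1 i.succ (homLagP L)) p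
      = p 1 0 * totD (pderY 1 i (lagExt L)) (jetProj p)
        - totDP (fun q : PJet n => q 2 0 / q 1 0 ^ 2 * pderY 2 i (lagExt L) (jetProj q)) p := by
    rw [totDP_congr hp fun q hq => pderP_one_succ_homLagP hL hq i,
      totDP_sub (differentiableAt_comp_jetProj hVs hp) hd,
      totDP_comp_jetProj hVs (hΛ3.pderY 1 i) hp]
  have e2 : totDP (totDP (pderP 2 i.succ (homLagP L))) p
      = p 1 0 * totD (totD (pderY 2 i (lagExt L))) (jetProj p)
        - totDP (fun q : PJet n => q 2 0 / q 1 0 ^ 2 * pderY 2 i (lagExt L) (jetProj q)) p := by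
    have := totDP_congr hp fun q hq =>
      (totDP_congr hq fun q hq => pderP_two_succ_homLagP hL hq i).trans
        (totDP_comp_jetProj_div hWs hW3 hq)
    rw [this, totDP_sub (differentiableAt_comp_jetProj (contDiff_totD hWs) hp) hd,
      totDP_comp_jetProj (contDiff_totD hWs) (hW i).totD hp]
  rw [homEP, e1, e2, pderP_zero_succ_homLagP hL hp, eulerPoisson2]
  ring

theorem homEP_zero {n : ℕ} {L : Jet n 3 → ℝ} (hL : ContDiff ℝ ∞ L)
    (hW : ∀ i, JetOrderLT 2 (pderY 2 i (lagExt L))) {p : PJet n} (hp : 0 < p 1 0) :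
    homEP L 0 p = -∑ i : Fin n, p 1 i.succ * eulerPoisson2 L i (jetProj p) := by
  have h0 : p 1 0 ≠ 0 := hp.ne'
  have hΛ : ContDiff ℝ ∞ (lagExt L) := contDiff_extJ _ hL
  have hΛ3 : JetOrderLT 3 (lagExt L) := jetOrderLT_extJ _ L
  have hWs := fun i => contDiff_pderY hΛ 2 i
  have hVs := fun i => contDiff_pderY hΛ 1 i
  have hWDs := fun i => contDiff_totD (hWs i)
  have hrow : ∀ (r : Fin 5) (i : Fin n), ContDiff ℝ ∞ fun q : Jet n 5 => q.2 r i :=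
    fun r i => by fun_prop
  set VV : Jet n 5 → ℝ := fun q => ∑ i, q.2 1 i * pderY 1 i (lagExt L) q with hVV
  set WW : Jet n 5 → ℝ := fun q => ∑ i, q.2 2 i * pderY 2 i (lagExt L) q with hWW
  set VW : Jet n 5 → ℝ := fun q => ∑ i, q.2 1 i * pderY 2 i (lagExt L) q with hVW
  set VDW : Jet n 5 → ℝ := fun q => ∑ i, q.2 1 i * totD (pderY 2 i (lagExt L)) q with hVDW
  have sVV : ContDiff ℝ ∞ VV := ContDiff.sum fun i _ => (hrow 1 i).mul (hVs i)
  have sWW : ContDiff ℝ ∞ WW := ContDiff.sum fun i _ => (hrow 2 i).mul (hWs i)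
  have sVW : ContDiff ℝ ∞ VW := ContDiff.sum fun i _ => (hrow 1 i).mul (hWs i)
  have sVDW : ContDiff ℝ ∞ VDW := ContDiff.sum fun i _ => (hrow 1 i).mul (hWDs i)
  have oVV : JetOrderLT 3 VV := .sum _ fun i _ => (JetOrderLT.row 1 (by simp) i).mul (hΛ3.pderY 1 i)
  have oWW : JetOrderLT 3 WW := .sum _ fun i _ => (JetOrderLT.row 2 (by simp) i).mul (hΛ3.pderY 2 i)
  have oVW : JetOrderLT 2 VW := .sum _ fun i _ => (JetOrderLT.row 1 (by simp) i).mul (hW i)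
  have diff : ∀ {F : Jet n 5 → ℝ}, ContDiff ℝ ∞ F → ∀ q, DifferentiableAt ℝ F q :=
    fun hF => hF.differentiable (by simp)
  have sH : ContDiff ℝ ∞ fun q => lagExt L q - VV q - (WW q + WW q) :=
    (hΛ.sub sVV).sub (sWW.add sWW)
  have oH : JetOrderLT 3 fun q => lagExt L q - VV q - (WW q + WW q) :=
    (hΛ3.sub oVV).sub (oWW.add oWW)
  have hd : DifferentiableAt ℝ (fun q : PJet n => q 2 0 / q 1 0 ^ 2 * VW (jetProj q)) p := by
    have h0 : p 1 0 ^ 2 ≠ 0 := pow_ne_zero _ hp.ne'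
    have hs : DifferentiableAt ℝ (fun q : PJet n => q 2 0 / q 1 0 ^ 2) p := by
      fun_prop (disch := assumption)
    exact hs.fun_mul (differentiableAt_comp_jetProj sVW hp)
  have e1 : totDP (pderP 1 0 (homLagP L)) p
      = p 1 0 * totD (fun q => lagExt L q - VV q - (WW q + WW q)) (jetProj p)
        + totDP (fun q : PJet n => q 2 0 / q 1 0 ^ 2 * VW (jetProj q)) p := by
    rw [← totDP_comp_jetProj sH oH hp, ← totDP_add (differentiableAt_comp_jetProj sH hp) hd]
    exact totDP_congr hp fun q hq => pderP_one_zero_homLagP hL hq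
  have e2 : totDP (totDP (pderP 2 0 (homLagP L))) p
      = -(p 1 0 * totD (totD VW) (jetProj p)
        - totDP (fun q : PJet n => q 2 0 / q 1 0 ^ 2 * VW (jetProj q)) p) := by
    have := totDP_congr hp fun q hq =>
      ((totDP_congr hq fun q hq => pderP_two_zero_homLagP hL hq).trans
        (totDP_neg _ q)).trans (congrArg Neg.neg
          (totDP_comp_jetProj_div sVW (oVW.mono (by omega)) hq))
    rw [this, totDP_neg, totDP_sub (differentiableAt_comp_jetProj (contDiff_totD sVW) hp) hd,
      totDP_comp_jetProj (contDiff_totD sVW) oVW.totD hp]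
  have dVW : totD VW = fun q => WW q + VDW q := by
    funext q
    rw [hVW, totD_sum _ fun i _ => diff ((hrow 1 i).mul (hWs i)) q, hWW, hVDW,
      ← Finset.sum_add_distrib]
    refine Finset.sum_congr rfl fun i _ => ?_
    rw [totD_mul (diff (hrow 1 i) q) (diff (hWs i) q), totD_row]
    rfl
  set P := jetProj p with hP
  have dVV : totD VV P = ∑ i, (P.2 2 i * pderY 1 i (lagExt L) P
      + P.2 1 i * totD (pderY 1 i (lagExt L)) P) := by
    rw [hVV, totD_sum _ fun i _ => diff ((hrow 1 i).mul (hVs i)) P]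
    refine Finset.sum_congr rfl fun i _ => ?_
    rw [totD_mul (diff (hrow 1 i) P) (diff (hVs i) P), totD_row]
    rfl
  have dWW : totD WW P = ∑ i, (P.2 3 i * pderY 2 i (lagExt L) P
      + P.2 2 i * totD (pderY 2 i (lagExt L)) P) := by
    rw [hWW, totD_sum _ fun i _ => diff ((hrow 2 i).mul (hWs i)) P]
    refine Finset.sum_congr rfl fun i _ => ?_
    rw [totD_mul (diff (hrow 2 i) P) (diff (hWs i) P), totD_row]
    rfl
  have dVDW : totD VDW P = ∑ i, (P.2 2 i * totD (pderY 2 i (lagExt L)) P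
      + P.2 1 i * totD (totD (pderY 2 i (lagExt L))) P) := by
    rw [hVDW, totD_sum _ fun i _ => diff ((hrow 1 i).mul (hWDs i)) P]
    refine Finset.sum_congr rfl fun i _ => ?_
    rw [totD_mul (diff (hrow 1 i) P) (diff (hWDs i) P), totD_row]
    rfl
  have hEP : ∑ i : Fin n, p 1 i.succ * eulerPoisson2 L i P
      = p 1 0 * ∑ i, P.2 1 i * eulerPoisson2 L i P := by
    rw [Finset.mul_sum]
    refine Finset.sum_congr rfl fun i _ => ?_
    simp [hP, jetProj]
    field_simp
  rw [homEP, e1, e2, dVW, pderP_zero_zero_homLagP hL hp, hEP,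
    totD_sub (diff (hΛ.sub sVV) P) (diff (sWW.add sWW) P), totD_sub (diff hΛ P) (diff sVV P),
    totD_add (diff sWW P) (diff sWW P), totD_add (diff sWW P) (diff sVDW P),
    totD_eq_of_jetOrderLT_three hΛ3, dVV, dWW, dVDW]
  simp only [eulerPoisson2, mul_add, mul_sub, Finset.sum_add_distrib, Finset.sum_sub_distrib]
  ring

/-- homogenization of the variational expressions.
For a smooth second-order Lagrange function `L(t,x,v,w)` affine in `w`, the Euler–Poisson
expressions `𝓔_α` of its parametric (homogeneous) counterpart
`𝓛 = u⁰·L(x⁰, x, u/u⁰, (u⁰a − a⁰u)/(u⁰)³)` satisfy, identically on `{u⁰ > 0}`: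
`𝓔₀ = −Σ_i u^i Ẽ_i` and `𝓔_i = u⁰ Ẽ_i`, where `Ẽ_i` denote the Euler–Poisson
expressions of `L` evaluated on the derivatives of `x` with respect to `x⁰`. -/
theorem statement_17 (n : ℕ) (hn : 1 ≤ n)
    (L : Jet n 3 → ℝ) (hL : ContDiff ℝ (⊤ : ℕ∞) L)
    (haff : ∃ (α : Fin n → Jet n 2 → ℝ) (β : Jet n 2 → ℝ),
      ∀ p : Jet n 3,
        L p = (∑ j, α j (trJ 2 (by omega) p) * coord p 2 j) + β (trJ 2 (by omega) p)) :
    ∀ p : PJet n, 0 < p 1 0 →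
      (homEP L 0 p = -∑ i : Fin n, p 1 i.succ * pulledEP L i p)
      ∧ (∀ i : Fin n, homEP L i.succ p = p 1 0 * pulledEP L i p) := by
  intro p hp
  have hW := jetOrderLT_pderY_two_lagExt hL haff
  exact ⟨homEP_zero hL hW hp, fun i => homEP_succ hL hW hp i⟩
end
end

section
/- Fix μ ∈ ℝ. On the open set Ω = {u = (u⁰, u¹, u²) ∈ ℝ³ : u⁰ > 0, (u⁰)² > (u¹)² + (u²)², (u¹, u²) ≠ (0, 0)}, write ‖u‖ = √((u⁰)² − (u¹)² − (u²)²) and define the three Lagrange functions of (u, a) ∈ Ω × ℝ³: 𝓛₀(u, a) = − u⁰ (a² u¹ − a¹ u²) / ( ‖u‖ ((u¹)² + (u²)²) ) + μ‖u‖; 𝓛₁(u, a) = u¹ (a⁰ u² − a² u⁰) / ( ‖u‖ ((u⁰)² − (u²)²) ) + μ‖u‖; 𝓛₂(u, a) = u² (a¹ u⁰ − a⁰ u¹) / ( ‖u‖ ((u⁰)² − (u¹)²) ) + μ‖u‖. For such a Lagrange function 𝓛 (affine in a, with ∂𝓛/∂a^α depending on u only), define its generalized momentum P_α(𝓛)(u,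 a) = ∂𝓛/∂u^α − Σ_β a^β ∂²𝓛/∂u^β∂a^α, α = 0, 1, 2. Then P(𝓛₀) = P(𝓛₁) = P(𝓛₂) identically on Ω × ℝ³: the generalized momentum does not depend on the choice of Lagrangian from this family. -/
noncomputable section

/-- The space of parametric velocities and accelerations `(u, a) ∈ ℝ³ × ℝ³`. -/
abbrev UA : Type := (Fin 3 → ℝ) × (Fin 3 → ℝ)

/-- The Minkowski length `‖u‖ = √((u⁰)² − (u¹)² − (u²)²)` for the metric
`g = diag(1, −1, −1)`. -/
def mnorm (u : Fin 3 → ℝ) : ℝ := Real.sqrt (u 0 ^ 2 - u 1 ^ 2 - u 2 ^ 2)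

/-- `𝓛₀ = −u⁰(a²u¹ − a¹u²)/(‖u‖((u¹)² + (u²)²)) + μ‖u‖`. -/
def Lag₀ (μ : ℝ) (p : UA) : ℝ :=
  -(p.1 0 * (p.2 2 * p.1 1 - p.2 1 * p.1 2)) / (mnorm p.1 * (p.1 1 ^ 2 + p.1 2 ^ 2))
    + μ * mnorm p.1

/-- `𝓛₁ = u¹(a⁰u² − a²u⁰)/(‖u‖((u⁰)² − (u²)²)) + μ‖u‖`. -/
def Lag₁ (μ : ℝ) (p : UA) : ℝ :=
  p.1 1 * (p.2 0 * p.1 2 - p.2 2 * p.1 0) / (mnorm p.1 * (p.1 0 ^ 2 - p.1 2 ^ 2))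
    + μ * mnorm p.1

/-- `𝓛₂ = u²(a¹u⁰ − a⁰u¹)/(‖u‖((u⁰)² − (u¹)²)) + μ‖u‖`. -/
def Lag₂ (μ : ℝ) (p : UA) : ℝ :=
  p.1 2 * (p.2 1 * p.1 0 - p.2 0 * p.1 1) / (mnorm p.1 * (p.1 0 ^ 2 - p.1 1 ^ 2))
    + μ * mnorm p.1

/-- The generalized momentum `P_α(𝓛) = ∂𝓛/∂u^α − Σ_β a^β ∂²𝓛/∂u^β∂a^α` of a Lagrange
function `𝓛(u, a)` affine in the accelerations `a`. -/
def genMom (F : UA → ℝ) (α : Fin 3) (p : UA) : ℝ :=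
  fderiv ℝ F p (Pi.single α 1, 0)
    - ∑ β : Fin 3, p.2 β *
        fderiv ℝ (fun q => fderiv ℝ F q (0, Pi.single α 1)) p (Pi.single β 1, 0)

open Filter Topology

theorem hasFDerivAt_mnorm {u : Fin 3 → ℝ} (hu : 0 < u 0 ^ 2 - u 1 ^ 2 - u 2 ^ 2) :
    HasFDerivAt mnorm
      ((mnorm u)⁻¹ • (u 0 • ContinuousLinearMap.proj (R := ℝ) (φ := fun _ : Fin 3 => ℝ) 0
        - u 1 • ContinuousLinearMap.proj (R := ℝ) (φ := fun _ : Fin 3 => ℝ) 1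
        - u 2 • ContinuousLinearMap.proj (R := ℝ) (φ := fun _ : Fin 3 => ℝ) 2)) u := by
  have hproj (i : Fin 3) := hasFDerivAt_apply (𝕜 := ℝ) i u
  have h := ((((hproj 0).pow 2).sub ((hproj 1).pow 2)).sub ((hproj 2).pow 2)).sqrt hu.ne'
  refine h.congr_fderiv ?_
  ext v
  have hn : Real.sqrt (u 0 ^ 2 - u 1 ^ 2 - u 2 ^ 2) ≠ 0 := (Real.sqrt_pos.2 hu).ne'
  simp [mnorm]
  field_simp

/-- The generalized momentum of `∑ β, a^β A_β(u) + N(u)` is governed by the curl of `A`. -/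
theorem genMom_of_affine {F : UA → ℝ} {A : Fin 3 → (Fin 3 → ℝ) → ℝ} {N : (Fin 3 → ℝ) → ℝ}
    (hF : ∀ q, F q = ∑ β, q.2 β * A β q.1 + N q.1) {p : UA}
    (hA : ∀ β, ∀ᶠ u in 𝓝 p.1, DifferentiableAt ℝ (A β) u)
    (hN : ∀ᶠ u in 𝓝 p.1, DifferentiableAt ℝ N u) (α : Fin 3) :
    genMom F α p = ∑ β, p.2 β * (fderiv ℝ (A β) p.1 (Pi.single α 1)
        - fderiv ℝ (A α) p.1 (Pi.single β 1)) + fderiv ℝ N p.1 (Pi.single α 1) := by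
  obtain rfl : F = fun q => ∑ β, q.2 β * A β q.1 + N q.1 := funext hF
  have hder {q : UA} (hAq : ∀ β, DifferentiableAt ℝ (A β) q.1) (hNq : DifferentiableAt ℝ N q.1)
      (v : UA) : fderiv ℝ (fun q : UA => ∑ β, q.2 β * A β q.1 + N q.1) q v
        = ∑ β, (q.2 β * fderiv ℝ (A β) q.1 v.1 + A β q.1 * v.2 β) + fderiv ℝ N q.1 v.1 := by
    have hacc (β : Fin 3) : HasFDerivAt (fun q : UA => q.2 β)
        ((ContinuousLinearMap.proj (R := ℝ) (φ := fun _ : Fin 3 => ℝ) β).comp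
          (ContinuousLinearMap.snd ℝ (Fin 3 → ℝ) (Fin 3 → ℝ))) q :=
      ((ContinuousLinearMap.proj (R := ℝ) (φ := fun _ : Fin 3 => ℝ) β).comp
          (ContinuousLinearMap.snd ℝ (Fin 3 → ℝ) (Fin 3 → ℝ))).hasFDerivAt
    have hcomp {G : (Fin 3 → ℝ) → ℝ} (hG : DifferentiableAt ℝ G q.1) :
        HasFDerivAt (fun q : UA => G q.1)
          ((fderiv ℝ G q.1).comp (ContinuousLinearMap.fst ℝ (Fin 3 → ℝ) (Fin 3 → ℝ))) q :=
      hG.hasFDerivAt.comp q hasFDerivAt_fst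
    have h := (HasFDerivAt.fun_sum (u := Finset.univ)
      fun β _ => (hacc β).mul (hcomp (hAq β))).add (hcomp hNq)
    refine (DFunLike.congr_fun (HasFDerivAt.fderiv h) v).trans ?_
    simp
  have hAll : ∀ᶠ u in 𝓝 p.1, ∀ β, DifferentiableAt ℝ (A β) u := eventually_all.2 hA
  have hinner : (fun q : UA => fderiv ℝ (fun q : UA => ∑ β, q.2 β * A β q.1 + N q.1) q
      (0, Pi.single α 1)) =ᶠ[𝓝 p] fun q => A α q.1 := by
    filter_upwards [continuous_fst.continuousAt.eventually (hAll.and hN)] with q hq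
    rw [hder hq.1 hq.2]
    simp [Pi.single_apply]
  have hsecond (v : UA) : fderiv ℝ (fun q : UA => A α q.1) p v = fderiv ℝ (A α) p.1 v.1 := by
    have h : HasFDerivAt (fun q : UA => A α q.1)
        ((fderiv ℝ (A α) p.1).comp (ContinuousLinearMap.fst ℝ (Fin 3 → ℝ) (Fin 3 → ℝ))) p :=
      (hAll.self_of_nhds α).hasFDerivAt.comp p hasFDerivAt_fst
    rw [h.fderiv]
    rfl
  rw [genMom, hinner.fderiv_eq, hder hAll.self_of_nhds hN.self_of_nhds]
  simp only [hsecond, Pi.zero_apply, mul_zero, add_zero, mul_sub, Finset.sum_sub_distrib]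
  ring

/-- The momentum of `(∑ β, a^β P_β(u)) / (‖u‖ D(u)) + μ‖u‖`, with the derivatives of the
quotients carried out. -/
theorem genMom_of_quotient {F : UA → ℝ} {μ : ℝ} {P : Fin 3 → (Fin 3 → ℝ) → ℝ}
    {D : (Fin 3 → ℝ) → ℝ}
    (hF : ∀ q, F q = ∑ β, q.2 β * (P β q.1 / (mnorm q.1 * D q.1)) + μ * mnorm q.1)
    (hP : ∀ β, Differentiable ℝ (P β)) (hD : Differentiable ℝ D) {p : UA}
    (hu : 0 < p.1 0 ^ 2 - p.1 1 ^ 2 - p.1 2 ^ 2) (hDp : D p.1 ≠ 0) (α : Fin 3) :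
    genMom F α p = ∑ β, p.2 β *
        (((fderiv ℝ (P β) p.1 (Pi.single α 1) - fderiv ℝ (P α) p.1 (Pi.single β 1)) * D p.1
          - (P β p.1 * fderiv ℝ D p.1 (Pi.single α 1)
            - P α p.1 * fderiv ℝ D p.1 (Pi.single β 1))) / (mnorm p.1 * D p.1 ^ 2)
        - (P β p.1 * ![p.1 0, -p.1 1, -p.1 2] α - P α p.1 * ![p.1 0, -p.1 1, -p.1 2] β)
          / (mnorm p.1 ^ 3 * D p.1))
      + μ * (![p.1 0, -p.1 1, -p.1 2] α / mnorm p.1) := by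
  have hopen : ∀ᶠ u in 𝓝 p.1, 0 < u 0 ^ 2 - u 1 ^ 2 - u 2 ^ 2 ∧ D u ≠ 0 :=
    (ContinuousAt.eventually_lt (by fun_prop) (by fun_prop) hu).and
      (hD.continuous.continuousAt.eventually_ne hDp)
  have hn {u : Fin 3 → ℝ} (h : 0 < u 0 ^ 2 - u 1 ^ 2 - u 2 ^ 2) : mnorm u ≠ 0 :=
    (Real.sqrt_pos.2 h).ne'
  have hgrad (i : Fin 3) : fderiv ℝ mnorm p.1 (Pi.single i 1)
      = ![p.1 0, -p.1 1, -p.1 2] i / mnorm p.1 := by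
    rw [(hasFDerivAt_mnorm hu).fderiv]
    fin_cases i <;> simp <;> ring
  have hquot (β i : Fin 3) :
      fderiv ℝ (fun u => P β u / (mnorm u * D u)) p.1 (Pi.single i 1)
        = (fderiv ℝ (P β) p.1 (Pi.single i 1) * D p.1
            - P β p.1 * fderiv ℝ D p.1 (Pi.single i 1)) / (mnorm p.1 * D p.1 ^ 2)
          - P β p.1 * ![p.1 0, -p.1 1, -p.1 2] i / (mnorm p.1 ^ 3 * D p.1) := by
    have hmD := (hasFDerivAt_mnorm hu).differentiableAt.hasFDerivAt.mul (hD p.1).hasFDerivAt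
    have h := (hP β p.1).hasFDerivAt.mul
      ((hasDerivAt_inv (mul_ne_zero (hn hu) hDp)).comp_hasFDerivAt p.1 hmD)
    have hn' := hn hu
    simp only [div_eq_mul_inv (P β _)]
    refine (DFunLike.congr_fun (HasFDerivAt.fderiv h) _).trans ?_
    simp only [add_apply, Function.comp_apply, Pi.mul_apply,
      smul_apply, smul_eq_mul, hgrad]
    field_simp
    ring
  rw [genMom_of_affine (A := fun β u => P β u / (mnorm u * D u)) (N := fun u => μ * mnorm u) hF]
  · rw [fderiv_const_mul (hasFDerivAt_mnorm hu).differentiableAt]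
    simp only [hquot, smul_apply, smul_eq_mul, hgrad]
    congr 1
    refine Finset.sum_congr rfl fun β _ => ?_
    ring
  · intro β
    filter_upwards [hopen] with u h
    simp only [div_eq_mul_inv]
    exact (hP β u).fun_mul (((hasFDerivAt_mnorm h.1).differentiableAt.fun_mul (hD u)).fun_inv
      (mul_ne_zero (hn h.1) h.2))
  · filter_upwards [hopen] with u h
    exact (hasFDerivAt_mnorm h.1).differentiableAt.const_mul μ

/-- The common momentum of the three Lagrangians. -/
def topMomentum (μ : ℝ) (p : UA) (α : Fin 3) : ℝ :=
  crossProduct p.1 p.2 α / mnorm p.1 ^ 3 + μ * (![p.1 0, -p.1 1, -p.1 2] α / mnorm p.1)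

theorem fderiv_mul_apply_single (i j α : Fin 3) (u : Fin 3 → ℝ) :
    fderiv ℝ (fun v : Fin 3 → ℝ => v i * v j) u (Pi.single α 1)
      = u i * (Pi.single α 1 : Fin 3 → ℝ) j + u j * (Pi.single α 1 : Fin 3 → ℝ) i := by
  have h := (hasFDerivAt_apply (𝕜 := ℝ) i u).mul (hasFDerivAt_apply (𝕜 := ℝ) j u)
  refine (DFunLike.congr_fun (HasFDerivAt.fderiv h) _).trans ?_
  simp

theorem fderiv_sq_add_sq_apply_single (i j α : Fin 3) (u : Fin 3 → ℝ) :
    fderiv ℝ (fun v : Fin 3 → ℝ => v i ^ 2 + v j ^ 2) u (Pi.single α 1)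
      = 2 * u i * (Pi.single α 1 : Fin 3 → ℝ) i + 2 * u j * (Pi.single α 1 : Fin 3 → ℝ) j := by
  have h := ((hasFDerivAt_apply (𝕜 := ℝ) i u).pow 2).add ((hasFDerivAt_apply (𝕜 := ℝ) j u).pow 2)
  refine (DFunLike.congr_fun (HasFDerivAt.fderiv h) _).trans ?_
  simp

theorem fderiv_sq_sub_sq_apply_single (i j α : Fin 3) (u : Fin 3 → ℝ) :
    fderiv ℝ (fun v : Fin 3 → ℝ => v i ^ 2 - v j ^ 2) u (Pi.single α 1)
      = 2 * u i * (Pi.single α 1 : Fin 3 → ℝ) i - 2 * u j * (Pi.single α 1 : Fin 3 → ℝ) j := by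
  have h := ((hasFDerivAt_apply (𝕜 := ℝ) i u).pow 2).sub ((hasFDerivAt_apply (𝕜 := ℝ) j u).pow 2)
  refine (DFunLike.congr_fun (HasFDerivAt.fderiv h) _).trans ?_
  simp

theorem genMom_Lag₀ (μ : ℝ) {p : UA} (hu : 0 < p.1 0 ^ 2 - p.1 1 ^ 2 - p.1 2 ^ 2)
    (hD : p.1 1 ^ 2 + p.1 2 ^ 2 ≠ 0) (α : Fin 3) :
    genMom (Lag₀ μ) α p = topMomentum μ p α := by
  have hn : mnorm p.1 ≠ 0 := (Real.sqrt_pos.2 hu).ne'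
  have hsq : mnorm p.1 ^ 2 = p.1 0 ^ 2 - p.1 1 ^ 2 - p.1 2 ^ 2 := Real.sq_sqrt hu.le
  rw [genMom_of_quotient (μ := μ)
    (P := ![fun v => 0, fun v => v 0 * v 2, fun v => -(v 0 * v 1)])
    (D := fun v => v 1 ^ 2 + v 2 ^ 2) ?_ ?_ (by fun_prop) hu hD, topMomentum]
  · congr 1
    fin_cases α <;>
      simp [Fin.sum_univ_three, cross_apply, fderiv_mul_apply_single,
        fderiv_sq_add_sq_apply_single] <;>
      field_simp <;> rw [hsq] <;> ring
  · intro q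
    simp only [Lag₀, Fin.sum_univ_three, Matrix.cons_val]
    ring
  · intro β
    fin_cases β <;> simp <;> fun_prop

theorem genMom_Lag₁ (μ : ℝ) {p : UA} (hu : 0 < p.1 0 ^ 2 - p.1 1 ^ 2 - p.1 2 ^ 2)
    (hD : p.1 0 ^ 2 - p.1 2 ^ 2 ≠ 0) (α : Fin 3) :
    genMom (Lag₁ μ) α p = topMomentum μ p α := by
  have hn : mnorm p.1 ≠ 0 := (Real.sqrt_pos.2 hu).ne'
  have hsq : mnorm p.1 ^ 2 = p.1 0 ^ 2 - p.1 1 ^ 2 - p.1 2 ^ 2 := Real.sq_sqrt hu.le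
  rw [genMom_of_quotient (μ := μ)
    (P := ![fun v => v 1 * v 2, fun v => 0, fun v => -(v 0 * v 1)])
    (D := fun v => v 0 ^ 2 - v 2 ^ 2) ?_ ?_ (by fun_prop) hu hD, topMomentum]
  · congr 1
    fin_cases α <;>
      simp [Fin.sum_univ_three, cross_apply, fderiv_mul_apply_single,
        fderiv_sq_sub_sq_apply_single] <;>
      field_simp <;> rw [hsq] <;> ring
  · intro q
    simp only [Lag₁, Fin.sum_univ_three, Matrix.cons_val]
    ring
  · intro β
    fin_cases β <;> simp <;> fun_prop

theorem genMom_Lag₂ (μ : ℝ) {p : UA} (hu : 0 < p.1 0 ^ 2 - p.1 1 ^ 2 - p.1 2 ^ 2)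
    (hD : p.1 0 ^ 2 - p.1 1 ^ 2 ≠ 0) (α : Fin 3) :
    genMom (Lag₂ μ) α p = topMomentum μ p α := by
  have hn : mnorm p.1 ≠ 0 := (Real.sqrt_pos.2 hu).ne'
  have hsq : mnorm p.1 ^ 2 = p.1 0 ^ 2 - p.1 1 ^ 2 - p.1 2 ^ 2 := Real.sq_sqrt hu.le
  rw [genMom_of_quotient (μ := μ)
    (P := ![fun v => -(v 1 * v 2), fun v => v 0 * v 2, fun v => 0])
    (D := fun v => v 0 ^ 2 - v 1 ^ 2) ?_ ?_ (by fun_prop) hu hD, topMomentum]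
  · congr 1
    fin_cases α <;>
      simp [Fin.sum_univ_three, cross_apply, fderiv_mul_apply_single,
        fderiv_sq_sub_sq_apply_single] <;>
      field_simp <;> rw [hsq] <;> ring
  · intro q
    simp only [Lag₂, Fin.sum_univ_three, Matrix.cons_val]
    ring
  · intro β
    fin_cases β <;> simp <;> fun_prop

/-- On the open set
`Ω = {u : u⁰ > 0, (u⁰)² > (u¹)² + (u²)², (u¹,u²) ≠ (0,0)}` the generalized momenta of the
three homogeneous Lagrangians `𝓛₀, 𝓛₁, 𝓛₂` of the free relativistic top in flat
three-dimensional space-time coincide identically: the generalized momentum does not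
depend on the choice of Lagrangian from this family. -/
theorem statement_18 (μ : ℝ) :
    ∀ p : UA, 0 < p.1 0 → p.1 1 ^ 2 + p.1 2 ^ 2 < p.1 0 ^ 2 →
      ¬(p.1 1 = 0 ∧ p.1 2 = 0) →
      ∀ α : Fin 3,
        genMom (Lag₀ μ) α p = genMom (Lag₁ μ) α p
        ∧ genMom (Lag₁ μ) α p = genMom (Lag₂ μ) α p := by
  intro p h0 hu hne α
  have hpos : 0 < p.1 0 ^ 2 - p.1 1 ^ 2 - p.1 2 ^ 2 := by linarith
  have h12 : p.1 1 ^ 2 + p.1 2 ^ 2 ≠ 0 := fun h =>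
    hne ⟨by nlinarith [sq_nonneg (p.1 1), sq_nonneg (p.1 2)],
      by nlinarith [sq_nonneg (p.1 1), sq_nonneg (p.1 2)]⟩
  have h02 : p.1 0 ^ 2 - p.1 2 ^ 2 ≠ 0 := by nlinarith [sq_nonneg (p.1 1)]
  have h01 : p.1 0 ^ 2 - p.1 1 ^ 2 ≠ 0 := by nlinarith [sq_nonneg (p.1 2)]
  rw [genMom_Lag₀ μ hpos h12, genMom_Lag₁ μ hpos h02, genMom_Lag₂ μ hpos h01]
  exact ⟨rfl, rfl⟩
end
end
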